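/- Let K be an algebraically closed field of characteristic zero, d ≥ 4, 0 ≤ δ ≤ d, and A = K⟨v1,…,vd⟩ the free associative K-algebra. Let 1_{δ,d} = (1,…,1,−1,…,−1) ∈ K^d with δ entries equal to 1 followed by d−δ entries equal to −1. Then every K-linear map ⟪-,-⟫ : A⊗A → A⊗A satisfying the Leibniz rules with ⟪v_i,v_i⟫ = 0 for all 1≤i≤d; ⟪v_i,v_j⟫ = v_i⊗v_j and ⟪v_j,v_i⟫ = −v_i⊗v_j for 1≤i<j≤δ; ⟪v_i,v_k⟫ = −(v_kv_i)⊗1 and ⟪v_k,v_i⟫ = (v_iv_k)⊗1 for 1≤i≤δ<k≤d; ⟪v_k,v_l⟫ = −v_k⊗v_l and ⟪v_l,v_k⟫ = v_k⊗v_l for δ<k<l≤d, is a mixed double Poisson algebra structure on A of weight 1_{δ,d}; in particular, it is a modified double Poisson bracket on A. -/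

import Mathlib

open TensorProduct

noncomputable section

variable (K : Type*) [Field K]
variable (A : Type*) [Ring A] [Algebra K A]

/-- Leibniz rules for a double-bracket-type operation. -/
def LeibnizRules (D : A ⊗[K] A →ₗ[K] A ⊗[K] A) : Prop :=
  (∀ a b c : A,
      D (a ⊗ₜ[K] (b * c)) =
        (b ⊗ₜ[K] (1 : A)) * D (a ⊗ₜ[K] c) + D (a ⊗ₜ[K] b) * ((1 : A) ⊗ₜ[K] c))
  ∧ (∀ a b c : A,
      D ((a * b) ⊗ₜ[K] c) =
        ((1 : A) ⊗ₜ[K] a) * D (b ⊗ₜ[K] c) + D (a ⊗ₜ[K] c) * (b ⊗ₜ[K] (1 : A)))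

/-- The associated bracket `{a,b} = m(⟪a,b⟫)`. -/
def br (D : A ⊗[K] A →ₗ[K] A ⊗[K] A) (a b : A) : A :=
  LinearMap.mul' K A (D (a ⊗ₜ[K] b))

/-- The K-span of commutators `[A,A]`. -/
def commutatorSpan : Submodule K A :=
  Submodule.span K {x : A | ∃ a b : A, x = a * b - b * a}

/-- The flip on `A ⊗ A`. -/
def flipT : A ⊗[K] A →ₗ[K] A ⊗[K] A := (TensorProduct.comm K A A).toLinearMap

/-- Swap of the last two tensor factors of `(A ⊗ A) ⊗ A`. -/
def swap23 : ((A ⊗[K] A) ⊗[K] A) →ₗ[K] ((A ⊗[K] A) ⊗[K] A) :=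
  (TensorProduct.assoc K A A A).symm.toLinearMap ∘ₗ
    (LinearMap.lTensor A (TensorProduct.comm K A A).toLinearMap) ∘ₗ
    (TensorProduct.assoc K A A A).toLinearMap

/-- `⟪a, -⟫_L` on double tensors: `b ⊗ c ↦ ⟪a,b⟫ ⊗ c`. -/
def dL (D : A ⊗[K] A →ₗ[K] A ⊗[K] A) (a : A) :
    A ⊗[K] A →ₗ[K] (A ⊗[K] A) ⊗[K] A :=
  LinearMap.rTensor A (D ∘ₗ TensorProduct.mk K A A a)

/-- `⟪a, -⟫_R` on double tensors: `b ⊗ c ↦ b ⊗ ⟪a,c⟫`. -/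
def dR (D : A ⊗[K] A →ₗ[K] A ⊗[K] A) (a : A) :
    A ⊗[K] A →ₗ[K] (A ⊗[K] A) ⊗[K] A :=
  (TensorProduct.assoc K A A A).symm.toLinearMap ∘ₗ
    LinearMap.lTensor A (D ∘ₗ TensorProduct.mk K A A a)

/-- `⟪-, c⟫_L` on double tensors: `b ⊗ b' ↦ ⟪b,c⟫' ⊗ b' ⊗ ⟪b,c⟫''`. -/
def dLfst (D : A ⊗[K] A →ₗ[K] A ⊗[K] A) (c : A) :
    A ⊗[K] A →ₗ[K] (A ⊗[K] A) ⊗[K] A :=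
  swap23 K A ∘ₗ LinearMap.rTensor A (D ∘ₗ (TensorProduct.mk K A A).flip c)

/-- The double Jacobiator. -/
def DJac (D : A ⊗[K] A →ₗ[K] A ⊗[K] A) (a b c : A) : (A ⊗[K] A) ⊗[K] A :=
  dL K A D a (D (b ⊗ₜ[K] c)) - dR K A D b (D (a ⊗ₜ[K] c)) - dLfst K A D c (D (a ⊗ₜ[K] b))

/-- `c ⊗₁ (-)` : `w' ⊗ w'' ↦ w' ⊗ c ⊗ w''`. -/
def otimes1 (c : A) : A ⊗[K] A →ₗ[K] (A ⊗[K] A) ⊗[K] A :=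
  LinearMap.rTensor A ((TensorProduct.mk K A A).flip c)

variable {ι : Type*}

/-- Mixed double algebra structure of weight `lam` with respect to the generators `v`. -/
def IsMixedDouble (v : ι → A) (lam : ι → K) (D : A ⊗[K] A →ₗ[K] A ⊗[K] A) : Prop :=
  LeibnizRules K A D ∧
  ∀ i j : ι,
    D (v i ⊗ₜ[K] v j) + flipT K A (D (v j ⊗ₜ[K] v i)) =
      ((lam i + lam j) / 2) • (v i ⊗ₜ[K] v j - v j ⊗ₜ[K] v i) +
      ((lam i - lam j) / 2) • ((1 : A) ⊗ₜ[K] (v i * v j) - (v j * v i) ⊗ₜ[K] (1 : A))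

/-- Mixed double Poisson algebra structure of weight `lam` w.r.t. the generators `v`. -/
def IsMixedDoublePoisson (v : ι → A) (lam : ι → K) (D : A ⊗[K] A →ₗ[K] A ⊗[K] A) : Prop :=
  IsMixedDouble K A v lam D ∧
  ∀ i j k : ι,
    DJac K A D (v i) (v j) (v k) =
      (-((lam i + lam j) / 2)) • otimes1 K A (v j) (D (v i ⊗ₜ[K] v k)) +
      ((lam i - lam j) / 2) •
        otimes1 K A (1 : A) (((1 : A) ⊗ₜ[K] v j) * D (v i ⊗ₜ[K] v k))

/-- Modified double Poisson bracket. -/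
def IsModifiedDoublePoisson (D : A ⊗[K] A →ₗ[K] A ⊗[K] A) : Prop :=
  LeibnizRules K A D ∧
  (∀ a b : A, br K A D a b + br K A D b a ∈ commutatorSpan K A) ∧
  (∀ a b c : A,
    br K A D a (br K A D b c) - br K A D b (br K A D a c) - br K A D (br K A D a b) c = 0)

end


namespace MDP

section gen

variable {K : Type*} [Field K] {A : Type*} [Ring A] [Algebra K A]

/-- Embedding in slots 1,3. -/
noncomputable def i13 : A ⊗[K] A →ₐ[K] (A ⊗[K] A) ⊗[K] A :=
  Algebra.TensorProduct.map Algebra.TensorProduct.includeLeft (AlgHom.id K A)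

/-- Embedding in slots 2,3. -/
noncomputable def i23 : A ⊗[K] A →ₐ[K] (A ⊗[K] A) ⊗[K] A :=
  Algebra.TensorProduct.map Algebra.TensorProduct.includeRight (AlgHom.id K A)

/-- Embedding in slots 1,2. -/
noncomputable def i12 : A ⊗[K] A →ₐ[K] (A ⊗[K] A) ⊗[K] A :=
  Algebra.TensorProduct.includeLeft

@[simp] lemma i13_tmul (x y : A) : i13 (x ⊗ₜ[K] y) = (x ⊗ₜ[K] (1 : A)) ⊗ₜ[K] y := rfl
@[simp] lemma i23_tmul (x y : A) : i23 (x ⊗ₜ[K] y) = ((1 : A) ⊗ₜ[K] x) ⊗ₜ[K] y := rfl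
@[simp] lemma i12_tmul (x y : A) : i12 (x ⊗ₜ[K] y) = (x ⊗ₜ[K] y) ⊗ₜ[K] (1 : A) := rfl

/-- Slot 1. -/
noncomputable def e1 (x : A) : (A ⊗[K] A) ⊗[K] A := (x ⊗ₜ[K] (1 : A)) ⊗ₜ[K] (1 : A)
/-- Slot 2. -/
noncomputable def e2 (x : A) : (A ⊗[K] A) ⊗[K] A := ((1 : A) ⊗ₜ[K] x) ⊗ₜ[K] (1 : A)
/-- Slot 3. -/
noncomputable def e3 (x : A) : (A ⊗[K] A) ⊗[K] A := ((1 : A) ⊗ₜ[K] (1 : A)) ⊗ₜ[K] x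

@[simp] lemma flipT_tmul (x y : A) : flipT K A (x ⊗ₜ[K] y) = y ⊗ₜ[K] x := rfl

variable (D : A ⊗[K] A →ₗ[K] A ⊗[K] A)

lemma dL_tmul (a x y : A) : dL K A D a (x ⊗ₜ[K] y) = i12 (D (a ⊗ₜ[K] x)) * e3 y := by
  simp [dL, i12, e3, ← Algebra.TensorProduct.one_def]

lemma dR_tmul (a x y : A) : dR K A D a (x ⊗ₜ[K] y) = e1 x * i23 (D (a ⊗ₜ[K] y)) := by
  simp only [dR, LinearMap.comp_apply, LinearMap.lTensor_tmul, TensorProduct.mk_apply]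
  induction D (a ⊗ₜ[K] y) using TensorProduct.induction_on with
  | zero => simp
  | tmul u v => simp [e1]
  | add u v hu hv => simp only [TensorProduct.tmul_add, map_add, hu, hv, mul_add]

lemma dLfst_tmul (c x y : A) :
    dLfst K A D c (x ⊗ₜ[K] y) = i13 (D (x ⊗ₜ[K] c)) * e2 y := by
  simp only [dLfst, LinearMap.comp_apply, LinearMap.rTensor_tmul, TensorProduct.mk_apply,
    LinearMap.flip_apply]
  induction D (x ⊗ₜ[K] c) using TensorProduct.induction_on with
  | zero => simp
  | tmul u v => simp [e2, swap23]
  | add u v hu hv => simp only [TensorProduct.add_tmul, map_add, hu, hv, add_mul]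

lemma otimes1_eq (c : A) (w : A ⊗[K] A) : otimes1 K A c w = e2 c * i13 w := by
  induction w using TensorProduct.induction_on with
  | zero => simp
  | tmul u v => simp [e2, otimes1]
  | add u v hu hv => simp only [map_add, hu, hv, mul_add]

variable {D} (hL : LeibnizRules K A D)
include hL

lemma D_one_left (c : A) : D ((1 : A) ⊗ₜ[K] c) = 0 := by
  have := hL.2 1 1 c
  simpa [← Algebra.TensorProduct.one_def] using this

lemma D_one_right (c : A) : D (c ⊗ₜ[K] (1 : A)) = 0 := by
  have := hL.1 c 1 1
  simpa [← Algebra.TensorProduct.one_def] using this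

omit hL in
lemma dL_1 (a b : A) (w : A ⊗[K] A) :
    dL K A D a (((1 : A) ⊗ₜ[K] b) * w) = e3 b * dL K A D a w := by
  induction w using TensorProduct.induction_on with
  | zero => simp
  | add u v hu hv => simp only [map_add, hu, hv, mul_add]
  | tmul u v =>
    simp only [Algebra.TensorProduct.tmul_mul_tmul, dL_tmul, one_mul]
    induction D (a ⊗ₜ[K] u) using TensorProduct.induction_on with
    | zero => simp
    | add u v hu hv => simp only [map_add, add_mul, hu, hv, mul_add]
    | tmul p q => simp [e3]

lemma dL_2 (a b : A) (w : A ⊗[K] A) :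
    dL K A D a (w * (b ⊗ₜ[K] (1 : A))) =
      dL K A D a w * e2 b + i13 w * i12 (D (a ⊗ₜ[K] b)) := by
  induction w using TensorProduct.induction_on with
  | zero => simp
  | add u v hu hv => simp only [map_add, hu, hv, add_mul]; abel
  | tmul u v =>
    simp only [Algebra.TensorProduct.tmul_mul_tmul, dL_tmul, mul_one, hL.1, map_add, add_mul]
    rw [add_comm]
    congr 1
    · induction D (a ⊗ₜ[K] u) using TensorProduct.induction_on with
      | zero => simp
      | add u v hu hv => simp only [map_add, add_mul, hu, hv]
      | tmul p q => simp [e3, e2]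
    · induction D (a ⊗ₜ[K] b) using TensorProduct.induction_on with
      | zero => simp
      | add u v hu hv => simp only [map_add, add_mul, hu, hv, mul_add]
      | tmul p q => simp [e3]

lemma dR_mul (a b : A) (w : A ⊗[K] A) :
    dR K A D (a * b) w = e3 a * dR K A D b w + dR K A D a w * e2 b := by
  induction w using TensorProduct.induction_on with
  | zero => simp
  | add u v hu hv => simp only [map_add, hu, hv, add_mul, mul_add]; abel
  | tmul u v =>
    simp only [dR_tmul, hL.2, map_add, mul_add]
    congr 1
    · induction D (b ⊗ₜ[K] v) using TensorProduct.induction_on with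
      | zero => simp
      | add u v hu hv => simp only [map_add, mul_add, hu, hv]
      | tmul p q => simp [e3, e1]
    · induction D (a ⊗ₜ[K] v) using TensorProduct.induction_on with
      | zero => simp
      | add u v hu hv => simp only [map_add, add_mul, hu, hv, mul_add]
      | tmul p q => simp [e1, e2]

lemma dL_mul (a b : A) (w : A ⊗[K] A) :
    dL K A D (a * b) w = e2 a * dL K A D b w + dL K A D a w * e1 b := by
  induction w using TensorProduct.induction_on with
  | zero => simp
  | add u v hu hv => simp only [map_add, hu, hv, add_mul, mul_add]; abel
  | tmul u v =>
    simp only [dL_tmul, hL.2, map_add, add_mul]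
    congr 1
    · induction D (b ⊗ₜ[K] u) using TensorProduct.induction_on with
      | zero => simp
      | add u v hu hv => simp only [map_add, add_mul, mul_add, hu, hv]
      | tmul p q => simp [e3, e2]
    · induction D (a ⊗ₜ[K] u) using TensorProduct.induction_on with
      | zero => simp
      | add u v hu hv => simp only [map_add, add_mul, hu, hv]
      | tmul p q => simp [e1, e3]

lemma dR_1 (b a : A) (w : A ⊗[K] A) :
    dR K A D b (((1 : A) ⊗ₜ[K] a) * w) =
      e2 a * dR K A D b w + i23 (D (b ⊗ₜ[K] a)) * i13 w := by
  induction w using TensorProduct.induction_on with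
  | zero => simp
  | add u v hu hv => simp only [map_add, hu, hv, mul_add]; abel
  | tmul u v =>
    simp only [Algebra.TensorProduct.tmul_mul_tmul, dR_tmul, one_mul, hL.1, map_add, mul_add]
    congr 1
    · induction D (b ⊗ₜ[K] v) using TensorProduct.induction_on with
      | zero => simp
      | add u v hu hv => simp only [map_add, mul_add, hu, hv]
      | tmul p q => simp [e1, e2]
    · induction D (b ⊗ₜ[K] a) using TensorProduct.induction_on with
      | zero => simp
      | add u v hu hv => simp only [map_add, add_mul, hu, hv, mul_add]
      | tmul p q => simp [e1]

omit hL in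
lemma dR_2 (b a : A) (w : A ⊗[K] A) :
    dR K A D b (w * (a ⊗ₜ[K] (1 : A))) = dR K A D b w * e1 a := by
  induction w using TensorProduct.induction_on with
  | zero => simp
  | add u v hu hv => simp only [map_add, hu, hv, add_mul]
  | tmul u v =>
    simp only [Algebra.TensorProduct.tmul_mul_tmul, dR_tmul, mul_one]
    induction D (b ⊗ₜ[K] v) using TensorProduct.induction_on with
    | zero => simp
    | add u v hu hv => simp only [map_add, add_mul, mul_add, hu, hv]
    | tmul p q => simp [e1]

omit hL in
lemma dF_1 (c b : A) (w : A ⊗[K] A) :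
    dLfst K A D c (w * ((1 : A) ⊗ₜ[K] b)) = dLfst K A D c w * e2 b := by
  induction w using TensorProduct.induction_on with
  | zero => simp
  | add u v hu hv => simp only [map_add, hu, hv, add_mul]
  | tmul u v =>
    simp only [Algebra.TensorProduct.tmul_mul_tmul, dLfst_tmul, mul_one]
    simp [e2, mul_assoc]

lemma dF_2 (c b : A) (w : A ⊗[K] A) :
    dLfst K A D c ((b ⊗ₜ[K] (1 : A)) * w) =
      e3 b * dLfst K A D c w + i13 (D (b ⊗ₜ[K] c)) * i12 w := by
  induction w using TensorProduct.induction_on with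
  | zero => simp
  | add u v hu hv => simp only [map_add, hu, hv, mul_add]; abel
  | tmul u v =>
    simp only [Algebra.TensorProduct.tmul_mul_tmul, dLfst_tmul, one_mul, hL.2, map_add, add_mul,
      map_mul]
    simp [e2, e3, mul_assoc]

omit hL in
lemma dF_3 (c a : A) (w : A ⊗[K] A) :
    dLfst K A D c (((1 : A) ⊗ₜ[K] a) * w) = e2 a * dLfst K A D c w := by
  induction w using TensorProduct.induction_on with
  | zero => simp
  | add u v hu hv => simp only [map_add, hu, hv, mul_add]
  | tmul u v =>
    simp only [Algebra.TensorProduct.tmul_mul_tmul, dLfst_tmul, one_mul]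
    induction D (u ⊗ₜ[K] c) using TensorProduct.induction_on with
    | zero => simp
    | add u v hu hv => simp only [map_add, add_mul, mul_add, hu, hv]
    | tmul p q => simp [e2]

lemma dF_4 (c a : A) (w : A ⊗[K] A) :
    dLfst K A D c (w * (a ⊗ₜ[K] (1 : A))) =
      dLfst K A D c w * e1 a + i23 (flipT K A w) * i13 (D (a ⊗ₜ[K] c)) := by
  induction w using TensorProduct.induction_on with
  | zero => simp
  | add u v hu hv => simp only [map_add, hu, hv, add_mul]; abel
  | tmul u v =>
    simp only [Algebra.TensorProduct.tmul_mul_tmul, dLfst_tmul, mul_one, hL.2, map_add, add_mul]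
    rw [add_comm]
    congr 1
    · induction D (u ⊗ₜ[K] c) using TensorProduct.induction_on with
      | zero => simp
      | add u v hu hv => simp only [map_add, add_mul, hu, hv]
      | tmul p q => simp [e1, e2]
    · induction D (a ⊗ₜ[K] c) using TensorProduct.induction_on with
      | zero => simp
      | add u v hu hv => simp only [map_add, add_mul, hu, hv, mul_add]
      | tmul p q => simp [e2]

lemma DJac_mul_mid (a b b' c : A) :
    DJac K A D a (b * b') c = e3 b * DJac K A D a b' c + DJac K A D a b c * e2 b' := by
  simp only [DJac, hL.2 b b' c, hL.1 a b b', map_add, dL_1, dL_2 hL, dR_mul hL, dF_1, dF_2 hL, mul_sub, sub_mul]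
  abel

lemma DJac_mul_left (a a' b c : A) :
    DJac K A D (a * a') b c = e2 a * DJac K A D a' b c + DJac K A D a b c * e1 a'
      - i23 (D (b ⊗ₜ[K] a) + flipT K A (D (a ⊗ₜ[K] b))) * i13 (D (a' ⊗ₜ[K] c)) := by
  simp only [DJac, hL.2 a a' c, hL.2 a a' b, map_add, dL_mul hL, dR_1 hL, dR_2, dF_3, dF_4 hL, mul_sub, sub_mul,
    add_mul]
  abel

omit hL
/-- Triple multiplication. -/
noncomputable def m3 : (A ⊗[K] A) ⊗[K] A →ₗ[K] A :=
  LinearMap.mul' K A ∘ₗ LinearMap.rTensor A (LinearMap.mul' K A)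

@[simp] lemma m3_tmul (x y z : A) : m3 ((x ⊗ₜ[K] y) ⊗ₜ[K] z) = x * y * z := by
  simp [m3]

lemma m3_cyc (b : A) (Z : (A ⊗[K] A) ⊗[K] A) : m3 (e3 b * Z) = m3 (Z * e2 b) := by
  induction Z using TensorProduct.induction_on with
  | zero => simp
  | add u v hu hv => simp only [map_add, hu, hv, mul_add, add_mul]
  | tmul u v =>
    induction u using TensorProduct.induction_on with
    | zero => simp
    | add u v hu hv => simp only [map_add, TensorProduct.add_tmul, hu, hv, mul_add, add_mul]
    | tmul p q => simp [e3, e2, mul_assoc]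

/-- `u ↦ w' u w''`. -/
noncomputable def sand (w : A ⊗[K] A) (u : A) : A := LinearMap.mul' K A (w * (u ⊗ₜ[K] (1 : A)))

lemma m3_i23_i13 (n w : A ⊗[K] A) : m3 (i23 n * i13 w) = sand w (LinearMap.mul' K A n) := by
  unfold sand
  induction w using TensorProduct.induction_on with
  | zero => simp
  | add u v hu hv => simp only [map_add, hu, hv, mul_add, add_mul]
  | tmul u v =>
    induction n using TensorProduct.induction_on with
    | zero => simp
    | add u v hu hv => simp only [map_add, TensorProduct.add_tmul, hu, hv, mul_add, add_mul]
    | tmul p q => simp [mul_assoc]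

lemma mul'_mul_left (b : A) (w : A ⊗[K] A) :
    LinearMap.mul' K A ((b ⊗ₜ[K] (1 : A)) * w) = b * LinearMap.mul' K A w := by
  induction w using TensorProduct.induction_on with
  | zero => simp
  | add u v hu hv => simp only [map_add, hu, hv, mul_add]
  | tmul u v => simp [mul_assoc]

lemma mul'_mul_right (b : A) (w : A ⊗[K] A) :
    LinearMap.mul' K A (w * ((1 : A) ⊗ₜ[K] b)) = LinearMap.mul' K A w * b := by
  induction w using TensorProduct.induction_on with
  | zero => simp
  | add u v hu hv => simp only [map_add, hu, hv, add_mul]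
  | tmul u v => simp [mul_assoc]

lemma mul'_mid (b : A) (w : A ⊗[K] A) :
    LinearMap.mul' K A (((1 : A) ⊗ₜ[K] b) * w) = LinearMap.mul' K A (w * (b ⊗ₜ[K] (1 : A))) := by
  induction w using TensorProduct.induction_on with
  | zero => simp
  | add u v hu hv => simp only [map_add, hu, hv, add_mul, mul_add]
  | tmul u v => simp [mul_assoc]

lemma m3_i12_e3 (u : A ⊗[K] A) (y : A) : m3 (i12 u * e3 y) = LinearMap.mul' K A u * y := by
  induction u using TensorProduct.induction_on with
  | zero => simp
  | add u v hu hv => simp only [map_add, hu, hv, add_mul]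
  | tmul u v => simp [e3]

lemma m3_e1_i23 (u : A ⊗[K] A) (y : A) : m3 (e1 y * i23 u) = y * LinearMap.mul' K A u := by
  induction u using TensorProduct.induction_on with
  | zero => simp
  | add u v hu hv => simp only [map_add, hu, hv, mul_add]
  | tmul u v => simp [e1, mul_assoc]

lemma m3_i13_e2 (u : A ⊗[K] A) (y : A) : m3 (i13 u * e2 y) = sand u y := by
  unfold sand
  induction u using TensorProduct.induction_on with
  | zero => simp
  | add u v hu hv => simp only [map_add, hu, hv, add_mul]
  | tmul u v => simp [e2]

lemma sand_mul (w : A ⊗[K] A) (x y : A) : sand (w * (x ⊗ₜ[K] (1 : A))) y = sand w (x * y) := by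
  simp [sand, mul_assoc]

lemma sand_mul' (w : A ⊗[K] A) (x y : A) : sand (((1 : A) ⊗ₜ[K] x) * w) y = sand w (y * x) := by
  rw [sand, mul_assoc, mul'_mid]
  simp [sand, mul_assoc]

lemma sand_add (w w' : A ⊗[K] A) (y : A) : sand (w + w') y = sand w y + sand w' y := by
  simp [sand, add_mul]

lemma sand_add_right (w : A ⊗[K] A) (x y : A) : sand w (x + y) = sand w x + sand w y := by
  simp [sand, mul_add, TensorProduct.add_tmul]

lemma sand_zero_right (w : A ⊗[K] A) : sand w 0 = 0 := by
  simp [sand]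

include hL

lemma br_mul_right (a b c : A) : br K A D a (b * c) = b * br K A D a c + br K A D a b * c := by
  simp only [br, hL.1, map_add, mul'_mul_left, mul'_mul_right]

lemma br_mul_left (a b c : A) :
    br K A D (a * b) c = sand (D (b ⊗ₜ[K] c)) a + sand (D (a ⊗ₜ[K] c)) b := by
  simp only [br, hL.2, map_add, mul'_mid, sand]

lemma br_m_right (a : A) (w : A ⊗[K] A) :
    br K A D a (LinearMap.mul' K A w) = m3 (dL K A D a w) + m3 (dR K A D a w) := by
  induction w using TensorProduct.induction_on with
  | zero => simp [br]
  | add u v hu hv =>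
    simp only [br, TensorProduct.tmul_add, map_add] at *
    rw [hu, hv]; abel
  | tmul u v =>
    simp only [LinearMap.mul'_apply, br_mul_right hL, dL_tmul, dR_tmul, m3_i12_e3, m3_e1_i23]
    simp only [br]; abel

lemma br_m_left (c : A) (w : A ⊗[K] A) :
    br K A D (LinearMap.mul' K A w) c =
      m3 (dLfst K A D c w) + m3 (dLfst K A D c (flipT K A w)) := by
  induction w using TensorProduct.induction_on with
  | zero => simp [br]
  | add u v hu hv =>
    simp only [br, TensorProduct.add_tmul, map_add] at *
    rw [hu, hv]; abel
  | tmul u v =>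
    simp only [LinearMap.mul'_apply, br_mul_left hL, dLfst_tmul, flipT_tmul, m3_i13_e2]
    abel

lemma jac_eq (a b c : A) :
    br K A D a (br K A D b c) - br K A D b (br K A D a c) - br K A D (br K A D a b) c =
      m3 (DJac K A D a b c) - m3 (DJac K A D b a c)
        - m3 (dLfst K A D c (D (b ⊗ₜ[K] a) + flipT K A (D (a ⊗ₜ[K] b)))) := by
  conv_lhs => rw [br.eq_def K A D b c, br.eq_def K A D a c, br.eq_def K A D a b]
  simp only [br_m_right hL, br_m_left hL, DJac, map_add, map_sub]
  abel

lemma mF_1 (c a : A) (N : A ⊗[K] A) :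
    m3 (dLfst K A D c (N * ((1 : A) ⊗ₜ[K] a) - (a ⊗ₜ[K] (1 : A)) * N)) =
      - sand (D (a ⊗ₜ[K] c)) (LinearMap.mul' K A N) := by
  induction N using TensorProduct.induction_on with
  | zero => simp [sand]
  | add u v hu hv =>
    rw [map_add, sand_add_right, neg_add, ← hu, ← hv, ← map_add, ← map_add]
    congr 2; noncomm_ring
  | tmul x y =>
    simp only [Algebra.TensorProduct.tmul_mul_tmul, map_sub, dLfst_tmul, m3_i13_e2, hL.2,
      sand_add, sand_mul, sand_mul', LinearMap.mul'_apply, mul_one, one_mul]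
    abel

lemma mF_2 (c b : A) (N : A ⊗[K] A) :
    m3 (dLfst K A D c (N * (b ⊗ₜ[K] (1 : A)) - ((1 : A) ⊗ₜ[K] b) * N)) =
      sand (D (b ⊗ₜ[K] c)) (LinearMap.mul' K A (flipT K A N)) := by
  induction N using TensorProduct.induction_on with
  | zero => simp [sand]
  | add u v hu hv =>
    rw [map_add, map_add, sand_add_right, ← hu, ← hv, ← map_add, ← map_add]
    congr 2; noncomm_ring
  | tmul x y =>
    simp only [Algebra.TensorProduct.tmul_mul_tmul, map_sub, dLfst_tmul, m3_i13_e2, hL.2,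
      sand_add, sand_mul, sand_mul', LinearMap.mul'_apply, mul_one, one_mul, flipT_tmul]
    abel

end gen

section commutations

variable {K : Type*} [Field K] {A : Type*} [Ring A] [Algebra K A]

lemma e2_i13 (b : A) (w : A ⊗[K] A) : e2 b * i13 w = i13 w * e2 b := by
  induction w using TensorProduct.induction_on with
  | zero => simp
  | add u v hu hv => simp only [map_add, hu, hv, mul_add, add_mul]
  | tmul u v => simp [e2]

lemma e2_e3 (a b : A) : (e2 a : (A ⊗[K] A) ⊗[K] A) * e3 b = e3 b * e2 a := by
  simp [e2, e3]

lemma e1_e2 (a b : A) : (e1 a : (A ⊗[K] A) ⊗[K] A) * e2 b = e2 b * e1 a := by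
  simp [e2, e1]

lemma e2_mul (a b : A) : (e2 (a * b) : (A ⊗[K] A) ⊗[K] A) = e2 a * e2 b := by
  simp [e2]

lemma e3_mul (a b : A) : (e3 (a * b) : (A ⊗[K] A) ⊗[K] A) = e3 a * e3 b := by
  simp [e3]

lemma i23_left (x : A) : (i23 (x ⊗ₜ[K] (1 : A))) = e2 x := rfl
lemma i23_right (x : A) : (i23 ((1 : A) ⊗ₜ[K] x)) = e3 x := rfl
lemma i13_left (x : A) : (i13 (x ⊗ₜ[K] (1 : A))) = e1 x := rfl
lemma i13_right (x : A) : (i13 ((1 : A) ⊗ₜ[K] x)) = e3 x := rfl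

lemma flipT_mul (u w : A ⊗[K] A) : flipT K A (u * w) = flipT K A u * flipT K A w := by
  have : ∀ z, flipT K A z = Algebra.TensorProduct.comm K A A z := fun z => rfl
  simp [this]

lemma flipT_flipT (u : A ⊗[K] A) : flipT K A (flipT K A u) = u := by
  simp [flipT]

variable (D : A ⊗[K] A →ₗ[K] A ⊗[K] A)

lemma DJac_add_mid (a b b' c : A) :
    DJac K A D a (b + b') c = DJac K A D a b c + DJac K A D a b' c := by
  simp only [DJac, dR, dL, dLfst, TensorProduct.add_tmul, TensorProduct.tmul_add, map_add,
    LinearMap.comp_add, LinearMap.lTensor_add, LinearMap.add_apply]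
  abel

lemma DJac_smul_mid (r : K) (a b c : A) :
    DJac K A D a (r • b) c = r • DJac K A D a b c := by
  simp only [DJac, dR, dL, dLfst, ← TensorProduct.smul_tmul', TensorProduct.tmul_smul, map_smul,
    LinearMap.comp_smul, LinearMap.lTensor_smul, LinearMap.smul_apply, smul_sub]

lemma DJac_add_left (a a' b c : A) :
    DJac K A D (a + a') b c = DJac K A D a b c + DJac K A D a' b c := by
  simp only [DJac, dR, dL, dLfst, TensorProduct.add_tmul, TensorProduct.tmul_add, map_add,
    LinearMap.comp_add, LinearMap.rTensor_add, LinearMap.add_apply]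
  abel

lemma DJac_smul_left (r : K) (a b c : A) :
    DJac K A D (r • a) b c = r • DJac K A D a b c := by
  simp only [DJac, dR, dL, dLfst, ← TensorProduct.smul_tmul', TensorProduct.tmul_smul, map_smul,
    LinearMap.comp_smul, LinearMap.rTensor_smul, LinearMap.smul_apply, smul_sub]

variable {D}

lemma DJac_one_mid (hL : LeibnizRules K A D) (a c : A) : DJac K A D a 1 c = 0 := by
  have h := DJac_mul_mid hL a 1 1 c
  have h2 : (e2 1 : (A ⊗[K] A) ⊗[K] A) = 1 := rfl
  have h3 : (e3 1 : (A ⊗[K] A) ⊗[K] A) = 1 := rfl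
  simpa [h2, h3] using h

lemma DJac_one_left (hL : LeibnizRules K A D) (b c : A) : DJac K A D 1 b c = 0 := by
  have h := DJac_mul_left hL 1 1 b c
  have h2 : (e2 1 : (A ⊗[K] A) ⊗[K] A) = 1 := rfl
  have h3 : (e1 1 : (A ⊗[K] A) ⊗[K] A) = 1 := rfl
  simpa [h2, h3, D_one_left hL] using h

/-- Symmetric part of the bracket. -/
noncomputable def S (D : A ⊗[K] A →ₗ[K] A ⊗[K] A) (a b : A) : A ⊗[K] A :=
  D (a ⊗ₜ[K] b) + flipT K A (D (b ⊗ₜ[K] a))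

lemma S_mul_right (hL : LeibnizRules K A D) (a b b' : A) :
    S D a (b * b') = (b ⊗ₜ[K] (1 : A)) * S D a b' + S D a b * ((1 : A) ⊗ₜ[K] b') := by
  simp only [S, hL.1, hL.2, map_add, flipT_mul, flipT_tmul, mul_add, add_mul]
  abel

lemma S_mul_left (hL : LeibnizRules K A D) (a a' b : A) :
    S D (a * a') b = ((1 : A) ⊗ₜ[K] a) * S D a' b + S D a b * (a' ⊗ₜ[K] (1 : A)) := by
  simp only [S, hL.1, hL.2, map_add, flipT_mul, flipT_tmul, mul_add, add_mul]
  abel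

lemma S_add_right (a b b' : A) : S D a (b + b') = S D a b + S D a b' := by
  simp only [S, TensorProduct.add_tmul, TensorProduct.tmul_add, map_add]; abel

lemma S_add_left (a b b' : A) : S D (b + b') a = S D b a + S D b' a := by
  simp only [S, TensorProduct.add_tmul, TensorProduct.tmul_add, map_add]; abel

lemma S_smul_right (r : K) (a b : A) : S D a (r • b) = r • S D a b := by
  simp only [S, ← TensorProduct.smul_tmul', TensorProduct.tmul_smul, map_smul, smul_add]

lemma S_smul_left (r : K) (a b : A) : S D (r • a) b = r • S D a b := by
  simp only [S, ← TensorProduct.smul_tmul', TensorProduct.tmul_smul, map_smul, smul_add]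

lemma mul'_flip (w : A ⊗[K] A) :
    LinearMap.mul' K A (flipT K A w) - LinearMap.mul' K A w ∈ commutatorSpan K A := by
  induction w using TensorProduct.induction_on with
  | zero => simp
  | add u v hu hv =>
    have := Submodule.add_mem _ hu hv
    simp only [map_add]
    convert this using 1
    abel
  | tmul u v => exact Submodule.subset_span ⟨v, u, by simp⟩

end commutations

section free

variable {K : Type*} [Field K] {X : Type*}

lemma ind {P : FreeAlgebra K X → Prop} (one : P 1) (gen : ∀ i, P (FreeAlgebra.ι K i))
    (mul : ∀ a b, P a → P b → P (a * b)) (add : ∀ a b, P a → P b → P (a + b))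
    (smul : ∀ (r : K) a, P a → P (r • a)) (a : FreeAlgebra K X) : P a := by
  induction a using FreeAlgebra.induction with
  | grade0 r => rw [Algebra.algebraMap_eq_smul_one]; exact smul _ _ one
  | grade1 x => exact gen x
  | mul a b ha hb => exact mul _ _ ha hb
  | add a b ha hb => exact add _ _ ha hb

lemma exists_N (lam : X → K) : ∃ N : (FreeAlgebra K X) →ₗ[K] (FreeAlgebra K X) ⊗[K] (FreeAlgebra K X),
    (∀ a b, N (a * b) = (a ⊗ₜ[K] (1 : (FreeAlgebra K X))) * N b + N a * ((1 : (FreeAlgebra K X)) ⊗ₜ[K] b)) ∧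
    ∀ i, N (FreeAlgebra.ι K i) = (lam i / 2) •
      (FreeAlgebra.ι K i ⊗ₜ[K] (1 : (FreeAlgebra K X)) + (1 : (FreeAlgebra K X)) ⊗ₜ[K] FreeAlgebra.ι K i) := by
  let n : X → (FreeAlgebra K X) ⊗[K] (FreeAlgebra K X) := fun i => (lam i / 2) •
      (FreeAlgebra.ι K i ⊗ₜ[K] (1 : (FreeAlgebra K X)) + (1 : (FreeAlgebra K X)) ⊗ₜ[K] FreeAlgebra.ι K i)
  let φ : (FreeAlgebra K X) →ₐ[K] Matrix (Fin 2) (Fin 2) ((FreeAlgebra K X) ⊗[K] (FreeAlgebra K X)) := FreeAlgebra.lift K fun i =>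
    !![FreeAlgebra.ι K i ⊗ₜ[K] (1 : (FreeAlgebra K X)), n i; 0, (1 : (FreeAlgebra K X)) ⊗ₜ[K] FreeAlgebra.ι K i]
  have hφ : ∀ a, φ a 0 0 = a ⊗ₜ[K] (1 : (FreeAlgebra K X)) ∧ φ a 1 1 = (1 : (FreeAlgebra K X)) ⊗ₜ[K] a ∧ φ a 1 0 = 0 := by
    intro a
    induction a using ind with
    | one => simp [Algebra.TensorProduct.one_def]
    | gen i => simp [φ]
    | mul a b ha hb => simp [map_mul, Matrix.mul_apply, Fin.sum_univ_two, ha, hb]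
    | add a b ha hb => simp [map_add, ha, hb, TensorProduct.add_tmul, TensorProduct.tmul_add]
    | smul r a ha =>
      simp [map_smul, ha, TensorProduct.smul_tmul']
  refine ⟨(Matrix.entryLinearMap K ((FreeAlgebra K X) ⊗[K] (FreeAlgebra K X)) (0 : Fin 2) (1 : Fin 2)) ∘ₗ φ.toLinearMap, ?_, ?_⟩
  · intro a b
    simp [Matrix.mul_apply, Fin.sum_univ_two, hφ]
  · intro i
    simp [φ, n]

variable {D : (FreeAlgebra K X) ⊗[K] (FreeAlgebra K X) →ₗ[K] (FreeAlgebra K X) ⊗[K] (FreeAlgebra K X)} {lam : X → K} {N : (FreeAlgebra K X) →ₗ[K] (FreeAlgebra K X) ⊗[K] (FreeAlgebra K X)}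

lemma S_eq (h : IsMixedDouble K (FreeAlgebra K X) (FreeAlgebra.ι K) lam D)
    (hN : ∀ a b, N (a * b) = (a ⊗ₜ[K] (1 : (FreeAlgebra K X))) * N b + N a * ((1 : (FreeAlgebra K X)) ⊗ₜ[K] b))
    (hNi : ∀ i, N (FreeAlgebra.ι K i) = (lam i / 2) •
      (FreeAlgebra.ι K i ⊗ₜ[K] (1 : (FreeAlgebra K X)) + (1 : (FreeAlgebra K X)) ⊗ₜ[K] FreeAlgebra.ι K i)) (a b : (FreeAlgebra K X)) :
    S D a b = (flipT K (FreeAlgebra K X) (N a) * ((1 : (FreeAlgebra K X)) ⊗ₜ[K] b) - (b ⊗ₜ[K] (1 : (FreeAlgebra K X))) * flipT K (FreeAlgebra K X) (N a))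
      + (N b * (a ⊗ₜ[K] (1 : (FreeAlgebra K X))) - ((1 : (FreeAlgebra K X)) ⊗ₜ[K] a) * N b) := by
  have hL := h.1
  have hN1 : N 1 = 0 := by
    have := hN 1 1
    simpa [← Algebra.TensorProduct.one_def] using this
  have S1 : ∀ a, S D a 1 = 0 := fun a => by simp [S, D_one_left hL, D_one_right hL]
  have S2 : ∀ a, S D 1 a = 0 := fun a => by simp [S, D_one_left hL, D_one_right hL]
  induction a using ind with
  | one => simp [S2, hN1, ← Algebra.TensorProduct.one_def]
  | mul a a' ha ha' =>
    simp only [S_mul_left hL, ha, ha', hN, map_add, flipT_mul, flipT_tmul, mul_add, add_mul,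
      mul_sub, sub_mul]
    simp only [mul_assoc, Algebra.TensorProduct.tmul_mul_tmul, one_mul, mul_one]
    simp only [← mul_assoc, Algebra.TensorProduct.tmul_mul_tmul, one_mul, mul_one]
    abel
  | add a a' ha ha' =>
    simp only [S_add_left, ha, ha', map_add, TensorProduct.add_tmul, TensorProduct.tmul_add,
      add_mul, mul_add]
    abel
  | smul r a ha =>
    simp only [S_smul_left, ha, map_smul, ← TensorProduct.smul_tmul', TensorProduct.tmul_smul,
      smul_mul_assoc, mul_smul_comm, smul_add, smul_sub]
  | gen i =>
    induction b using ind with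
    | one => simp [S1, hN1, ← Algebra.TensorProduct.one_def]
    | mul a a' ha ha' =>
      simp only [S_mul_right hL, ha, ha', hN, map_add, flipT_mul, flipT_tmul, mul_add, add_mul,
        mul_sub, sub_mul]
      simp only [mul_assoc, Algebra.TensorProduct.tmul_mul_tmul, one_mul, mul_one]
      simp only [← mul_assoc, Algebra.TensorProduct.tmul_mul_tmul, one_mul, mul_one]
      abel
    | add a a' ha ha' =>
      simp only [S_add_right, ha, ha', map_add, TensorProduct.add_tmul, TensorProduct.tmul_add,
        add_mul, mul_add]
      abel
    | smul r a ha =>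
      simp only [S_smul_right, ha, map_smul, ← TensorProduct.smul_tmul', TensorProduct.tmul_smul,
        smul_mul_assoc, mul_smul_comm, smul_add, smul_sub]
    | gen j =>
      rw [S, h.2 i j]
      simp only [hNi, map_smul, map_add, flipT_tmul, smul_mul_assoc, mul_smul_comm, add_mul,
        mul_add, Algebra.TensorProduct.tmul_mul_tmul, one_mul, mul_one]
      module

lemma DJac_gen (h : IsMixedDoublePoisson K (FreeAlgebra K X) (FreeAlgebra.ι K) lam D)
    (hN : ∀ a b, N (a * b) = (a ⊗ₜ[K] (1 : (FreeAlgebra K X))) * N b + N a * ((1 : (FreeAlgebra K X)) ⊗ₜ[K] b))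
    (hNi : ∀ i, N (FreeAlgebra.ι K i) = (lam i / 2) •
      (FreeAlgebra.ι K i ⊗ₜ[K] (1 : (FreeAlgebra K X)) + (1 : (FreeAlgebra K X)) ⊗ₜ[K] FreeAlgebra.ι K i)) (i k : X) (b : (FreeAlgebra K X)) :
    DJac K (FreeAlgebra K X) D (FreeAlgebra.ι K i) b (FreeAlgebra.ι K k)
      + i23 (flipT K (FreeAlgebra K X) (N b)) * i13 (D (FreeAlgebra.ι K i ⊗ₜ[K] FreeAlgebra.ι K k)) =
    e3 b * ((lam i / 2) • i13 (D (FreeAlgebra.ι K i ⊗ₜ[K] FreeAlgebra.ι K k))) -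
      ((lam i / 2) • i13 (D (FreeAlgebra.ι K i ⊗ₜ[K] FreeAlgebra.ι K k))) * e2 b := by
  have hL := h.1.1
  have hN1 : N 1 = 0 := by
    have := hN 1 1
    simpa [← Algebra.TensorProduct.one_def] using this
  have h2 : (e2 1 : ((FreeAlgebra K X) ⊗[K] (FreeAlgebra K X)) ⊗[K] (FreeAlgebra K X)) = 1 := rfl
  have h3 : (e3 1 : ((FreeAlgebra K X) ⊗[K] (FreeAlgebra K X)) ⊗[K] (FreeAlgebra K X)) = 1 := rfl
  induction b using ind with
  | one => simp [DJac_one_mid hL, hN1, h2, h3]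
  | gen j =>
    rw [h.2 i j k]
    simp only [otimes1_eq, hNi, map_smul, map_add, flipT_tmul, map_mul, i23_left, i23_right,
      i13_right, h2, one_mul, smul_mul_assoc, mul_smul_comm, add_mul, ← e2_i13]
    module
  | mul a b ha hb =>
    rw [← eq_sub_iff_add_eq] at ha hb
    rw [DJac_mul_mid hL, ha, hb]
    simp only [hN, map_add, flipT_mul, flipT_tmul, map_mul, i23_left, i23_right, e2_mul, e3_mul,
      add_mul, mul_add, mul_sub, sub_mul, mul_assoc, e2_i13]
    abel
  | add a b ha hb =>
    rw [← eq_sub_iff_add_eq] at ha hb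
    have e3a : (e3 (a + b) : ((FreeAlgebra K X) ⊗[K] (FreeAlgebra K X)) ⊗[K] (FreeAlgebra K X)) = e3 a + e3 b := by
      simp [e3, TensorProduct.tmul_add]
    have e2a : (e2 (a + b) : ((FreeAlgebra K X) ⊗[K] (FreeAlgebra K X)) ⊗[K] (FreeAlgebra K X)) = e2 a + e2 b := by
      simp [e2, TensorProduct.tmul_add, TensorProduct.add_tmul]
    simp only [DJac_add_mid, ha, hb, map_add, e3a, e2a, add_mul, mul_add]
    abel
  | smul r a ha =>
    rw [← eq_sub_iff_add_eq] at ha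
    have e3a : (e3 (r • a) : ((FreeAlgebra K X) ⊗[K] (FreeAlgebra K X)) ⊗[K] (FreeAlgebra K X)) = r • e3 a := by
      simp [e3, TensorProduct.tmul_smul]
    have e2a : (e2 (r • a) : ((FreeAlgebra K X) ⊗[K] (FreeAlgebra K X)) ⊗[K] (FreeAlgebra K X)) = r • e2 a := by
      simp [e2, TensorProduct.tmul_smul, ← TensorProduct.smul_tmul']
    simp only [DJac_smul_mid, ha, map_smul, e3a, e2a, smul_mul_assoc, mul_smul_comm]
    module

lemma DJac_all (h : IsMixedDoublePoisson K (FreeAlgebra K X) (FreeAlgebra.ι K) lam D)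
    (hN : ∀ a b, N (a * b) = (a ⊗ₜ[K] (1 : (FreeAlgebra K X))) * N b + N a * ((1 : (FreeAlgebra K X)) ⊗ₜ[K] b))
    (hNi : ∀ i, N (FreeAlgebra.ι K i) = (lam i / 2) •
      (FreeAlgebra.ι K i ⊗ₜ[K] (1 : (FreeAlgebra K X)) + (1 : (FreeAlgebra K X)) ⊗ₜ[K] FreeAlgebra.ι K i)) (k : X) (a : (FreeAlgebra K X)) :
    ∃ Z, ∀ b, DJac K (FreeAlgebra K X) D a b (FreeAlgebra.ι K k) =
      e3 b * Z - Z * e2 b - i23 (flipT K (FreeAlgebra K X) (N b)) * i13 (D (a ⊗ₜ[K] FreeAlgebra.ι K k)) := by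
  have hL := h.1.1
  induction a using ind with
  | one => exact ⟨0, fun b => by simp [DJac_one_left hL, D_one_left hL]⟩
  | gen i => exact ⟨_, fun b => eq_sub_iff_add_eq.2 (DJac_gen h hN hNi i k b)⟩
  | add a a' ha ha' =>
    obtain ⟨Z, hZ⟩ := ha
    obtain ⟨Z', hZ'⟩ := ha'
    refine ⟨Z + Z', fun b => ?_⟩
    simp only [DJac_add_left, hZ, hZ', TensorProduct.add_tmul, map_add, mul_add, add_mul]
    abel
  | smul r a ha =>
    obtain ⟨Z, hZ⟩ := ha
    refine ⟨r • Z, fun b => ?_⟩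
    simp only [DJac_smul_left, hZ, ← TensorProduct.smul_tmul', map_smul, mul_smul_comm,
      smul_mul_assoc, smul_sub]
  | mul a a' ha ha' =>
    obtain ⟨Z, hZ⟩ := ha
    obtain ⟨Z', hZ'⟩ := ha'
    refine ⟨e2 a * Z' + Z * e1 a' + i23 (N a) * i13 (D (a' ⊗ₜ[K] FreeAlgebra.ι K k)),
      fun b => ?_⟩
    have hS := S_eq h.1 hN hNi b a
    rw [S] at hS
    have c1 : ∀ x y, (e2 a : ((FreeAlgebra K X) ⊗[K] (FreeAlgebra K X)) ⊗[K] (FreeAlgebra K X)) * (e3 x * y) = e3 x * (e2 a * y) := by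
      intro x y; rw [← mul_assoc, e2_e3, mul_assoc]
    rw [DJac_mul_left hL, hS, hZ, hZ', hL.2]
    simp only [map_add, map_sub, map_mul, i23_left, i23_right, i13_left, i13_right,
      add_mul, mul_add, mul_sub, sub_mul, mul_assoc, e2_i13, e1_e2, c1]
    abel

theorem mixed_to_modified (h : IsMixedDoublePoisson K (FreeAlgebra K X) (FreeAlgebra.ι K) lam D) :
    IsModifiedDoublePoisson K (FreeAlgebra K X) D := by
  have hL := h.1.1
  obtain ⟨N, hN, hNi⟩ := exists_N (K := K) lam
  refine ⟨hL, fun a b => ?_, fun a b c => ?_⟩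
  · have hS := S_eq h.1 hN hNi a b
    have h1 : LinearMap.mul' K (FreeAlgebra K X) (S D a b) ∈ commutatorSpan K (FreeAlgebra K X) := by
      rw [hS]
      simp only [map_add, map_sub, mul'_mul_left, mul'_mul_right, mul'_mid, sub_self, add_zero]
      exact Submodule.subset_span ⟨_, _, rfl⟩
    have h2 := mul'_flip (D (b ⊗ₜ[K] a))
    have := Submodule.sub_mem _ h1 h2
    simp only [S, map_add] at this
    simp only [br]
    convert this using 1
    abel
  · induction c using ind with
    | one => simp [br, D_one_right hL]
    | gen k =>
      obtain ⟨Z, hZ⟩ := DJac_all h hN hNi k a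
      obtain ⟨Z', hZ'⟩ := DJac_all h hN hNi k b
      have hS := S_eq h.1 hN hNi b a
      rw [S] at hS
      rw [jac_eq hL, hZ, hZ', hS, map_add, map_add, mF_1 hL, mF_2 hL]
      simp only [map_sub, m3_cyc, m3_i23_i13]
      abel
    | mul c c' hc hc' =>
      have add_r : ∀ a b c, br K (FreeAlgebra K X) D a (b + c) = br K (FreeAlgebra K X) D a b + br K (FreeAlgebra K X) D a c := by
        intro a b c; simp [br, TensorProduct.tmul_add]
      simp only [br_mul_right hL, add_r]
      rw [sub_eq_zero, sub_eq_iff_eq_add] at hc hc'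
      rw [hc, hc']
      noncomm_ring
    | add c c' hc hc' =>
      have add_r : ∀ a b c, br K (FreeAlgebra K X) D a (b + c) = br K (FreeAlgebra K X) D a b + br K (FreeAlgebra K X) D a c := by
        intro a b c; simp [br, TensorProduct.tmul_add]
      simp only [add_r]
      rw [sub_eq_zero, sub_eq_iff_eq_add] at hc hc'
      rw [hc, hc']
      abel
    | smul r c hc =>
      have smul_r : ∀ a c, br K (FreeAlgebra K X) D a (r • c) = r • br K (FreeAlgebra K X) D a c := by
        intro a c; simp [br, TensorProduct.tmul_smul]
      simp only [smul_r, ← smul_sub, hc, smul_zero]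

end free

end MDP

set_option maxHeartbeats 4000000 in
theorem MDP.table {K : Type*} [Field K] [CharZero K] {d : ℕ} (δ : ℕ)
    (D : FreeAlgebra K (Fin d) ⊗[K] FreeAlgebra K (Fin d) →ₗ[K]
      FreeAlgebra K (Fin d) ⊗[K] FreeAlgebra K (Fin d))
    (hL : LeibnizRules K (FreeAlgebra K (Fin d)) D)
    (hT : ∀ i j : Fin d, D (FreeAlgebra.ι K i ⊗ₜ[K] FreeAlgebra.ι K j) =
      if i = j then 0 else
      if (i : ℕ) < δ then
        if (j : ℕ) < δ then
          if i < j then FreeAlgebra.ι K i ⊗ₜ[K] FreeAlgebra.ι K j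
          else (-1 : K) • (FreeAlgebra.ι K j ⊗ₜ[K] FreeAlgebra.ι K i)
        else (-1 : K) • ((FreeAlgebra.ι K j * FreeAlgebra.ι K i) ⊗ₜ[K] (1 : FreeAlgebra K (Fin d)))
      else
        if (j : ℕ) < δ then (FreeAlgebra.ι K j * FreeAlgebra.ι K i) ⊗ₜ[K] (1 : FreeAlgebra K (Fin d))
        else
          if i < j then (-1 : K) • (FreeAlgebra.ι K i ⊗ₜ[K] FreeAlgebra.ι K j)
          else FreeAlgebra.ι K j ⊗ₜ[K] FreeAlgebra.ι K i) :
    IsMixedDoublePoisson K (FreeAlgebra K (Fin d)) (FreeAlgebra.ι K)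
        (fun i : Fin d => if (i : ℕ) < δ then (1 : K) else -1) D := by
  refine ⟨⟨hL, fun i j => ?_⟩, fun i j k => ?_⟩
  · rw [hT i j, hT j i]
    by_cases hi : (i : ℕ) < δ <;> by_cases hj : (j : ℕ) < δ <;>
      rcases lt_trichotomy i j with hij | hij | hij <;>
      first
      | (exfalso; omega)
      | (subst hij; simp; done)
      | (simp only [hi, hj, hij, hij.ne, hij.ne', hij.not_gt, if_true, if_false, map_smul,
          MDP.flipT_tmul]
         module)
  · have d1 := MDP.D_one_left hL
    have d2 := MDP.D_one_right hL
    have hT0 : ∀ i, D (FreeAlgebra.ι K i ⊗ₜ[K] FreeAlgebra.ι K i) = 0 := fun i => by simp [hT]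
    by_cases hi : (i : ℕ) < δ <;> by_cases hj : (j : ℕ) < δ <;> by_cases hk : (k : ℕ) < δ <;>
      rcases lt_trichotomy i j with hij | hij | hij <;>
      rcases lt_trichotomy j k with hjk | hjk | hjk <;>
      rcases lt_trichotomy i k with hik | hik | hik <;>
      first
      | (exfalso; omega)
      | (have t1 := hT i j
         have t2 := hT j i
         have t3 := hT i k
         have t4 := hT k i
         have t5 := hT j k
         have t6 := hT k j
         try simp only [hi, hj, hk, hij, ne_of_lt hij, ne_of_gt hij, not_lt_of_gt hij,
            if_true, if_false] at t1 t2
         try simp only [hi, hj, hk, hik, ne_of_lt hik, ne_of_gt hik, not_lt_of_gt hik,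
            if_true, if_false] at t3 t4
         try simp only [hi, hj, hk, hjk, ne_of_lt hjk, ne_of_gt hjk, not_lt_of_gt hjk,
            if_true, if_false] at t5 t6
         try subst hij
         try subst hjk
         try subst hik
         simp only [DJac, MDP.dL_tmul, MDP.dR_tmul, MDP.dLfst_tmul, MDP.otimes1_eq, MDP.e1, MDP.e2,
            MDP.e3, map_smul, smul_mul_assoc, mul_smul_comm, smul_zero, hL.1, hL.2, t1, t2, t3, t4, t5, t6, hT0, d1, d2, mul_add, add_mul, mul_neg,
            neg_mul, map_add, map_neg, map_zero, mul_zero, zero_mul, zero_add, add_zero,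
            MDP.i12_tmul, MDP.i13_tmul, MDP.i23_tmul, Algebra.TensorProduct.tmul_mul_tmul, mul_one,
            one_mul, mul_assoc, hi, hj, if_true, if_false, eq_self]
         module)

theorem stmt19 {K : Type*} [Field K] [IsAlgClosed K] [CharZero K]
    {d : ℕ} (hd : 4 ≤ d) (δ : ℕ) (hδ : δ ≤ d)
    (D : FreeAlgebra K (Fin d) ⊗[K] FreeAlgebra K (Fin d) →ₗ[K] FreeAlgebra K (Fin d) ⊗[K] FreeAlgebra K (Fin d))
    (hL : LeibnizRules K (FreeAlgebra K (Fin d)) D)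
    (hdiag : ∀ i : Fin d, D (FreeAlgebra.ι K i ⊗ₜ[K] FreeAlgebra.ι K i) = 0)
    (h1 : ∀ i j : Fin d, i < j → (j : ℕ) < δ →
      D (FreeAlgebra.ι K i ⊗ₜ[K] FreeAlgebra.ι K j) = FreeAlgebra.ι K i ⊗ₜ[K] FreeAlgebra.ι K j ∧
        D (FreeAlgebra.ι K j ⊗ₜ[K] FreeAlgebra.ι K i) = -(FreeAlgebra.ι K i ⊗ₜ[K] FreeAlgebra.ι K j))
    (h2 : ∀ i k : Fin d, (i : ℕ) < δ → δ ≤ (k : ℕ) →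
      D (FreeAlgebra.ι K i ⊗ₜ[K] FreeAlgebra.ι K k) = -((FreeAlgebra.ι K k * FreeAlgebra.ι K i) ⊗ₜ[K] (1 : FreeAlgebra K (Fin d))) ∧
        D (FreeAlgebra.ι K k ⊗ₜ[K] FreeAlgebra.ι K i) = (FreeAlgebra.ι K i * FreeAlgebra.ι K k) ⊗ₜ[K] (1 : FreeAlgebra K (Fin d)))
    (h3 : ∀ k l : Fin d, k < l → δ ≤ (k : ℕ) →
      D (FreeAlgebra.ι K k ⊗ₜ[K] FreeAlgebra.ι K l) = -(FreeAlgebra.ι K k ⊗ₜ[K] FreeAlgebra.ι K l) ∧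
        D (FreeAlgebra.ι K l ⊗ₜ[K] FreeAlgebra.ι K k) = FreeAlgebra.ι K k ⊗ₜ[K] FreeAlgebra.ι K l) :
    IsMixedDoublePoisson K (FreeAlgebra K (Fin d)) (FreeAlgebra.ι K)
        (fun i : Fin d => if (i : ℕ) < δ then (1 : K) else -1) D ∧
      IsModifiedDoublePoisson K (FreeAlgebra K (Fin d)) D := by
  suffices h : IsMixedDoublePoisson K (FreeAlgebra K (Fin d)) (FreeAlgebra.ι K)
        (fun i : Fin d => if (i : ℕ) < δ then (1 : K) else -1) D from ⟨h, MDP.mixed_to_modified h⟩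
  have hT : ∀ i j : Fin d, D (FreeAlgebra.ι K i ⊗ₜ[K] FreeAlgebra.ι K j) =
      if i = j then 0 else
      if (i : ℕ) < δ then
        if (j : ℕ) < δ then
          if i < j then FreeAlgebra.ι K i ⊗ₜ[K] FreeAlgebra.ι K j
          else -(FreeAlgebra.ι K j ⊗ₜ[K] FreeAlgebra.ι K i)
        else -((FreeAlgebra.ι K j * FreeAlgebra.ι K i) ⊗ₜ[K] (1 : FreeAlgebra K (Fin d)))
      else
        if (j : ℕ) < δ then (FreeAlgebra.ι K j * FreeAlgebra.ι K i) ⊗ₜ[K] (1 : FreeAlgebra K (Fin d))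
        else
          if i < j then -(FreeAlgebra.ι K i ⊗ₜ[K] FreeAlgebra.ι K j)
          else FreeAlgebra.ι K j ⊗ₜ[K] FreeAlgebra.ι K i := by
    intro i j
    split_ifs with a b c e e e
    · rw [a, hdiag]
    · exact (h1 i j e c).1
    · exact (h1 j i (lt_of_le_of_ne (not_lt.1 e) (Ne.symm a)) b).2
    · exact (h2 i j b (not_lt.1 c)).1
    · exact (h2 j i e (not_lt.1 b)).2
    · rename_i e'
      exact (h3 i j e (not_lt.1 b)).1
    · rename_i e'
      exact (h3 j i (lt_of_le_of_ne (not_lt.1 e) (Ne.symm a)) (not_lt.1 e')).2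
  refine MDP.table δ D hL fun i j => ?_
  rw [hT i j]
  split_ifs <;> module
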